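/- Let K be a field, P_0 = K[x_1,…,x_m], and M a finitely generated graded Cohen–Macaulay P_0-module whose minimal graded free resolution is pure of the form 0 → P_0^{β_s}(−d_s) → ⋯ → P_0^{β_1}(−d_1) → P_0^{β_0} → M → 0, where s = codim M. Then the multiplicity of M is e(M) = (β_0/s!) ∏_{i=1}^s d_i. -/

import Mathlib

/-!
Formalization of the Herzog–Kühl-type formulas (Propositions 4.6 and 4.7) of "On the
regularity of local cohomology of bigraded algebras" (A. Rahimi): for a finitely generated
graded Cohen–Macaulay module `M` over `P₀ = K[x₁,…,x_m]` with a pure minimal graded free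
resolution `0 → P₀^{β_s}(-d_s) → ⋯ → P₀^{β_1}(-d_1) → P₀^{β_0} → M → 0`, `s = codim M`
(note that exactness of such a resolution of length `s` together with `codim M = s` is
equivalent to `M` being Cohen–Macaulay of codimension `s`, by Auslander–Buchsbaum).
-/

open MvPolynomial

namespace Paper

/-- Total degree of an exponent vector. -/
def tdeg {m : ℕ} (ν : Fin m →₀ ℕ) : ℕ := ν.sum fun _ e => e

variable (K : Type) [Field K] (m : ℕ)

/-- The degree-`e` strand of the graded free module `⊕_{s : τ} P₀(-a s)`. -/
def strandG {τ : Type} (a : τ → ℕ) (e : ℤ) :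
    Submodule K (τ →₀ MvPolynomial (Fin m) K) where
  carrier := {w | ∀ s ν, MvPolynomial.coeff ν (w s) ≠ 0 → (tdeg ν : ℤ) + a s = e}
  add_mem' := by
    intro x y hx hy s ν h
    rw [Finsupp.add_apply, MvPolynomial.coeff_add] at h
    by_cases h1 : MvPolynomial.coeff ν (x s) ≠ 0
    · exact hx s ν h1
    · push_neg at h1
      exact hy s ν (by simpa [h1] using h)
  zero_mem' := by intro s ν h; simp at h
  smul_mem' := by
    intro k w hw s ν h
    rw [Finsupp.smul_apply, MvPolynomial.coeff_smul] at h
    exact hw s ν (right_ne_zero_of_smul h)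

section gradedPart

/-- Projections onto the pieces of a grading. -/
structure GrProj (K : Type) [Field K] {V : Type} [AddCommGroup V] [Module K V]
    (S : ℤ → Submodule K V) (π : ℤ → V →ₗ[K] V) : Prop where
  mem : ∀ e v, π e v ∈ S e
  self : ∀ e v, v ∈ S e → π e v = v
  ne : ∀ e e' v, v ∈ S e' → e' ≠ e → π e v = 0
  top : ⨆ e, S e = ⊤

section abstractGr
variable {K : Type} [Field K] {U V W : Type} [AddCommGroup U] [Module K U]
  [AddCommGroup V] [Module K V] [AddCommGroup W] [Module K W]
  {R : ℤ → Submodule K U} {ρ : ℤ → U →ₗ[K] U}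
  {S : ℤ → Submodule K V} {π : ℤ → V →ₗ[K] V} {T : ℤ → Submodule K W}

lemma GrProj.comm (hR : GrProj K R ρ) (hS : GrProj K S π) (f : U →ₗ[K] V)
    (hf : ∀ e u, u ∈ R e → f u ∈ S e) (e : ℤ) (u : U) : f (ρ e u) = π e (f u) := by
  have hu : u ∈ ⨆ e, R e := hR.top ▸ Submodule.mem_top
  induction hu using Submodule.iSup_induction' with
  | mem i x hx =>
    by_cases h : i = e
    · subst h
      rw [hR.self _ _ hx, hS.self _ _ (hf _ _ hx)]
    · rw [hR.ne _ _ _ hx h, hS.ne _ _ _ (hf _ _ hx) h, map_zero]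
  | zero => simp
  | add x y _ _ hx hy => simp only [map_add, hx, hy]

lemma GrProj.map_eq_of_surjective (hR : GrProj K R ρ) (hS : GrProj K S π) (f : U →ₗ[K] V)
    (hf : ∀ e u, u ∈ R e → f u ∈ S e) (hsurj : Function.Surjective f) (e : ℤ) :
    (R e).map f = S e := by
  apply le_antisymm
  · rintro _ ⟨u, hu, rfl⟩
    exact hf e u hu
  · intro v hv
    obtain ⟨u, rfl⟩ := hsurj v
    refine ⟨ρ e u, hR.mem e u, ?_⟩
    rw [hR.comm hS f hf, hS.self _ _ hv]

lemma GrProj.map_eq_of_exact (hR : GrProj K R ρ) (hS : GrProj K S π) (f : U →ₗ[K] V)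
    (g : V →ₗ[K] W) (hf : ∀ e u, u ∈ R e → f u ∈ S e) (hex : Function.Exact f g) (e : ℤ) :
    (R e).map f = S e ⊓ LinearMap.ker g := by
  apply le_antisymm
  · rintro _ ⟨u, hu, rfl⟩
    exact ⟨hf e u hu, hex.apply_apply_eq_zero u⟩
  · rintro v ⟨hv, hv0⟩
    obtain ⟨u, rfl⟩ := (hex v).mp hv0
    refine ⟨ρ e u, hR.mem e u, ?_⟩
    rw [hR.comm hS f hf, hS.self _ _ hv]

lemma finrank_map_add_inf (g : V →ₗ[K] W) (A : Submodule K V) [FiniteDimensional K A] :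
    Module.finrank K (A.map g) + Module.finrank K (A ⊓ LinearMap.ker g : Submodule K V) =
      Module.finrank K A := by
  have h := LinearMap.finrank_range_add_finrank_ker (g.domRestrict A)
  rw [LinearMap.range_domRestrict] at h
  rw [← h]
  congr 1
  rw [LinearMap.ker_domRestrict, ← Submodule.finrank_map_subtype_eq,
    Submodule.map_comap_subtype]

lemma GrProj.sum_finrank_le (hS : GrProj K S π) (n : ℕ) (B : Submodule K V)
    [FiniteDimensional K B] (hB : ∀ i : ℕ, i ≤ n → S i ≤ B) :
    ∑ i ∈ Finset.range (n + 1), Module.finrank K (S (i : ℤ)) ≤ Module.finrank K B := by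
  have hfd : ∀ i : Fin (n + 1), FiniteDimensional K (S (i : ℕ)) := fun i =>
    Submodule.finiteDimensional_of_le (hB i (Nat.le_of_lt_succ i.2))
  let L : (∀ i : Fin (n + 1), S ((i : ℕ) : ℤ)) →ₗ[K] V :=
    ∑ i : Fin (n + 1), (S ((i : ℕ) : ℤ)).subtype ∘ₗ LinearMap.proj i
  have hL : ∀ x, L x = ∑ i, (x i : V) := by
    intro x; simp [L]
  have hLB : ∀ x, L x ∈ B := by
    intro x
    rw [hL]
    exact Submodule.sum_mem _ fun i _ => hB i (Nat.le_of_lt_succ i.2) (x i).2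
  have hinj : Function.Injective (L.codRestrict B hLB) := by
    rw [← LinearMap.ker_eq_bot, LinearMap.ker_codRestrict, LinearMap.ker_eq_bot']
    intro x hx
    funext j
    have h1 : π ((j : ℕ) : ℤ) (L x) = x j := by
      rw [hL, map_sum, Finset.sum_eq_single j]
      · exact hS.self _ _ (x j).2
      · intro i _ hij
        refine hS.ne _ _ _ (x i).2 ?_
        intro h
        exact hij (Fin.ext (by exact_mod_cast h))
      · simp
    rw [hx, map_zero] at h1
    exact Subtype.ext h1.symm
  have h := LinearMap.finrank_le_finrank_of_injective hinj
  rw [Module.finrank_pi_fintype] at h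
  rwa [Finset.sum_range]

end abstractGr

section internal
variable {K : Type} [Field K] {M : Type} [AddCommGroup M] [Module K M]

lemma exists_grProj_of_isInternal (ℳ : ℤ → Submodule K M) (h : DirectSum.IsInternal ℳ) :
    ∃ π, GrProj K ℳ π := by
  let E := LinearEquiv.ofBijective (DirectSum.coeLinearMap ℳ) h
  have hE : ∀ i (x : M) (hx : x ∈ ℳ i), E.symm x = DirectSum.lof K ℤ (fun i => ℳ i) i ⟨x, hx⟩ := by
    intro i x hx
    rw [LinearEquiv.symm_apply_eq]
    exact (DirectSum.coeLinearMap_lof ℳ i ⟨x, hx⟩).symm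
  refine ⟨fun e => (ℳ e).subtype ∘ₗ DirectSum.component K ℤ (fun i => ℳ i) e ∘ₗ E.symm.toLinearMap,
    ?_, ?_, ?_, ?_⟩
  · intro e v
    exact Subtype.property _
  · intro e v hv
    simp [hE e v hv]
  · intro e e' v hv hne
    simp [hE e' v hv, DirectSum.component.of, hne]
  · exact h.submodule_iSup_eq_top
end internal

section strand
variable {K : Type} [Field K] {m : ℕ}

lemma tdeg_eq (ν : Fin m →₀ ℕ) : tdeg ν = ν.degree := by
  rw [tdeg, Finsupp.degree_eq_sum, Finsupp.sum_fintype _ _ (fun _ => rfl)]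

lemma mem_strandG {τ : Type} (a : τ → ℕ) (e : ℤ) (w : τ →₀ MvPolynomial (Fin m) K) :
    w ∈ strandG K m a e ↔ ∀ s ν, MvPolynomial.coeff ν (w s) ≠ 0 → (tdeg ν : ℤ) + a s = e := Iff.rfl

/-- projection to one strand -/
noncomputable def strandProj (K : Type) [Field K] (m b d : ℕ) (e : ℤ) :
    (Fin b →₀ MvPolynomial (Fin m) K) →ₗ[K] (Fin b →₀ MvPolynomial (Fin m) K) :=
  Finsupp.mapRange.linearMap
    (if (d : ℤ) ≤ e then homogeneousComponent (e - d).toNat else 0)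

lemma coeff_strandProj (b d : ℕ) (e : ℤ) (w : Fin b →₀ MvPolynomial (Fin m) K) (t : Fin b)
    (ν : Fin m →₀ ℕ) : coeff ν (strandProj K m b d e w t) =
      if (tdeg ν : ℤ) + d = e then coeff ν (w t) else 0 := by
  rw [strandProj, Finsupp.mapRange.linearMap_apply, Finsupp.mapRange_apply, tdeg_eq]
  split_ifs with h1 h2 h2
  · rw [coeff_homogeneousComponent, if_pos (by omega)]
  · rw [coeff_homogeneousComponent, if_neg (by omega)]
  · omega
  · simp

lemma grProj_strand (b d : ℕ) :
    GrProj K (strandG K m (fun _ : Fin b => d)) (strandProj K m b d) where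
  mem := by
    intro e v s ν h
    rw [coeff_strandProj] at h
    by_contra hne
    exact h (if_neg hne)
  self := by
    intro e v hv
    ext t ν
    rw [coeff_strandProj]
    split_ifs with h
    · rfl
    · by_contra hne
      exact h (hv t ν (Ne.symm hne))
  ne := by
    intro e e' v hv hne
    ext t ν
    rw [coeff_strandProj]
    split_ifs with h
    · by_contra hne'
      exact hne ((hv t ν hne').symm.trans h)
    · simp
  top := by
    rw [eq_top_iff]
    rintro w -
    induction w using Finsupp.induction_linear with
    | zero => exact Submodule.zero_mem _
    | add f g hf hg => exact Submodule.add_mem _ hf hg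
    | single t p =>
      induction p using MvPolynomial.induction_on' with
      | monomial ν c =>
        refine Submodule.mem_iSup_of_mem ((tdeg ν : ℤ) + d) ?_
        intro s μ h
        rw [Finsupp.single_apply] at h
        split_ifs at h with h1
        · rw [coeff_monomial] at h
          split_ifs at h with h2
          · rw [h2]
          · exact absurd rfl h
        · simp at h
      | add p q hp hq =>
        rw [Finsupp.single_add]
        exact Submodule.add_mem _ hp hq

/-- Coefficients give coordinates on a strand. -/
noncomputable def strandCoeff (K : Type) [Field K] (m b d n : ℕ) :
    strandG K m (fun _ : Fin b => d) ((n + d : ℕ) : ℤ) →ₗ[K]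
      (Fin b × (Finset.univ : Finset (Fin m)).finsuppAntidiag n → K) where
  toFun w x := coeff x.2.1 (w.1 x.1)
  map_add' := by intro x y; funext z; simp
  map_smul' := by intro x y; funext z; simp

lemma mem_antidiag (ν : Fin m →₀ ℕ) (n : ℕ) :
    ν ∈ (Finset.univ : Finset (Fin m)).finsuppAntidiag n ↔ tdeg ν = n := by
  rw [Finset.mem_finsuppAntidiag, tdeg, Finsupp.sum_fintype _ _ (fun _ => rfl)]
  simp

lemma strandCoeff_bijective (b d n : ℕ) : Function.Bijective (strandCoeff K m b d n) := by
  constructor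
  · refine (injective_iff_map_eq_zero _).mpr ?_
    rintro ⟨w, hw⟩ h0
    apply Subtype.ext
    ext t ν
    by_contra hne
    have h1 := hw t ν (by simpa using hne)
    have h2 : tdeg ν = n := by push_cast at h1; omega
    have h3 := congrFun h0 (t, ⟨ν, (mem_antidiag ν n).mpr h2⟩)
    exact hne (by simpa [strandCoeff] using h3)
  · intro f
    let w : Fin b →₀ MvPolynomial (Fin m) K := Finsupp.equivFunOnFinite.symm fun t =>
      ∑ ν : (Finset.univ : Finset (Fin m)).finsuppAntidiag n, monomial ν.1 (f (t, ν))
    have hc : ∀ t μ, coeff μ (w t) =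
        ∑ ν : (Finset.univ : Finset (Fin m)).finsuppAntidiag n, if ν.1 = μ then f (t, ν) else 0 := by
      intro t μ
      simp [w, coeff_sum, coeff_monomial]
    have hw : w ∈ strandG K m (fun _ : Fin b => d) ((n + d : ℕ) : ℤ) := by
      intro t μ h
      rw [hc] at h
      obtain ⟨ν, -, hν⟩ := Finset.exists_ne_zero_of_sum_ne_zero h
      split_ifs at hν with h1
      · have := (mem_antidiag _ _).mp ν.2
        rw [← h1, this]; push_cast; rfl
      · exact absurd rfl hν
    refine ⟨⟨w, hw⟩, ?_⟩
    funext ⟨t, μ⟩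
    change coeff μ.1 (w t) = _
    rw [hc, Finset.sum_eq_single μ]
    · simp
    · intro ν _ hne
      rw [if_neg (fun h => hne (Subtype.ext h))]
    · simp

lemma strand_finite (b d n : ℕ) :
    FiniteDimensional K (strandG K m (fun _ : Fin b => d) (n : ℤ)) ∧
    (0 < m → Module.finrank K (strandG K m (fun _ : Fin b => d) (n : ℤ)) =
      b * (if d ≤ n then (m - 1 + (n - d)).choose (m - 1) else 0)) := by
  by_cases h : d ≤ n
  · obtain ⟨k, rfl⟩ := Nat.exists_eq_add_of_le' h
    have E := LinearEquiv.ofBijective _ (strandCoeff_bijective (K := K) (m := m) b d k)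
    refine ⟨Module.Finite.equiv E.symm, fun hm => ?_⟩
    rw [E.finrank_eq, Module.finrank_fintype_fun_eq_card, if_pos h, Fintype.card_prod,
      Fintype.card_fin, Fintype.card_coe, Finset.card_finsuppAntidiag_nat_eq_choose,
      Nat.add_sub_cancel, Finset.card_univ, Fintype.card_fin,
      show m + k - 1 = m - 1 + k by omega, ← Nat.choose_symm_add]
  · have : strandG K m (fun _ : Fin b => d) (n : ℤ) = ⊥ := by
      rw [eq_bot_iff]
      intro w hw
      rw [Submodule.mem_bot]
      ext t ν
      by_contra hne
      have h1 := hw t ν (by simpa using hne)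
      simp only at h1
      omega
    rw [this, if_neg h]
    exact ⟨inferInstance, fun _ => by simp⟩

lemma strand_map {b b' : ℕ} (d d' : ℕ)
    (ψ : (Fin b →₀ MvPolynomial (Fin m) K) →ₗ[MvPolynomial (Fin m) K]
      (Fin b' →₀ MvPolynomial (Fin m) K))
    (hψ : ∀ s' t ν, coeff ν ((ψ (Finsupp.single s' 1)) t) ≠ 0 → tdeg ν + d' = d)
    (e : ℤ) (w : Fin b →₀ MvPolynomial (Fin m) K) (hw : w ∈ strandG K m (fun _ : Fin b => d) e) :
    ψ w ∈ strandG K m (fun _ : Fin b' => d') e := by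
  have hsum : ψ w = ∑ t, w t • ψ (Finsupp.single t 1) := by
    conv_lhs => rw [← Finsupp.univ_sum_single w]
    rw [map_sum]
    refine Finset.sum_congr rfl fun t _ => ?_
    rw [← map_smul, Finsupp.smul_single, smul_eq_mul, mul_one]
  rw [hsum]
  refine Submodule.sum_mem _ fun t _ => ?_
  intro t' ν h
  rw [Finsupp.smul_apply, smul_eq_mul, coeff_mul] at h
  obtain ⟨⟨x, y⟩, hxy, hne⟩ := Finset.exists_ne_zero_of_sum_ne_zero h
  have hxy' : x + y = ν := Finset.HasAntidiagonal.mem_antidiagonal.mp hxy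
  have h1 := hw t x (left_ne_zero_of_mul hne)
  have h2 := hψ t t' y (right_ne_zero_of_mul hne)
  rw [tdeg_eq] at h1 h2 ⊢
  rw [← hxy', map_add]
  push_cast
  simp only at h1
  omega

lemma strand_map_zero {b : ℕ} {M : Type} [AddCommGroup M]
    [Module K M] [Module (MvPolynomial (Fin m) K) M]
    [IsScalarTower K (MvPolynomial (Fin m) K) M]
    (ℳ : ℤ → Submodule K M)
    (hsmul : ∀ (e : ℕ) (p : MvPolynomial (Fin m) K), p.IsHomogeneous e →
      ∀ (i : ℤ) (x : M), x ∈ ℳ i → p • x ∈ ℳ (i + e))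
    (ε : (Fin b →₀ MvPolynomial (Fin m) K) →ₗ[MvPolynomial (Fin m) K] M)
    (hε : ∀ t, ε (Finsupp.single t 1) ∈ ℳ 0)
    (e : ℤ) (w : Fin b →₀ MvPolynomial (Fin m) K) (hw : w ∈ strandG K m (fun _ : Fin b => 0) e) :
    ε w ∈ ℳ e := by
  have hsum : ε w = ∑ t, w t • ε (Finsupp.single t 1) := by
    conv_lhs => rw [← Finsupp.univ_sum_single w]
    rw [map_sum]
    refine Finset.sum_congr rfl fun t _ => ?_
    rw [← map_smul, Finsupp.smul_single, smul_eq_mul, mul_one]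
  rw [hsum]
  refine Submodule.sum_mem _ fun t _ => ?_
  by_cases h0 : w t = 0
  · rw [h0, zero_smul]; exact Submodule.zero_mem _
  obtain ⟨ν, hν⟩ := MvPolynomial.ne_zero_iff.mp h0
  have h1 := hw t ν hν
  have he : e = 0 + ((tdeg ν : ℕ) : ℤ) := by simp at h1; omega
  rw [he]
  refine hsmul (tdeg ν) (w t) ?_ 0 _ (hε t)
  intro μ hμ
  have h2 := hw t μ hμ
  have hwt : Finsupp.weight 1 μ = tdeg μ := by
    rw [tdeg_eq, Finsupp.degree_eq_weight_one]; rfl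
  rw [hwt]
  simp only at h1 h2
  omega

end strand

lemma alt_sum (s : ℕ) (v r : ℕ → ℕ) (h : ∀ i, r i + r (i + 1) = v i) (h0 : r (s + 1) = 0) :
    (r 0 : ℚ) = ∑ i ∈ Finset.range (s + 1), (-1) ^ i * (v i : ℚ) := by
  have H : ∀ k, (r 0 : ℚ) = ∑ i ∈ Finset.range k, (-1) ^ i * (v i : ℚ) + (-1) ^ k * (r k : ℚ) := by
    intro k
    induction k with
    | zero => simp
    | succ k ih =>
      rw [ih, Finset.sum_range_succ, ← h k]
      push_cast
      ring
  rw [H (s + 1), h0]; simp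

end gradedPart

section polyPart
open Polynomial

/-- The operator sending p to X times its derivative minus c times p. -/
noncomputable def eulerOp (c : ℚ) (p : ℚ[X]) : ℚ[X] := Polynomial.X * derivative p - Polynomial.C c * p

lemma eulerOp_factor (c : ℚ) (k : ℕ) (g : ℚ[X]) :
    ∃ g' : ℚ[X], eulerOp c (g * (1 - Polynomial.X) ^ (k + 1)) = g' * (1 - Polynomial.X) ^ k ∧
      g'.eval 1 = -((k : ℚ) + 1) * g.eval 1 := by
  refine ⟨- (Polynomial.C ((k : ℚ) + 1)) * Polynomial.X * g + (1 - Polynomial.X) * (Polynomial.X * derivative g - Polynomial.C c * g), ?_, ?_⟩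
  · unfold eulerOp
    simp only [derivative_mul, derivative_pow, derivative_sub, derivative_one, derivative_X]
    simp
    ring
  · simp

lemma eulerOp_iter (c : ℕ → ℚ) (s : ℕ) : ∀ (g : ℚ[X]),
    (((List.range s).foldl (fun p j => eulerOp (c j) p) (g * (1 - Polynomial.X) ^ s))).eval 1 =
      (-1) ^ s * (s.factorial : ℚ) * g.eval 1 := by
  suffices H : ∀ (l : List ℕ) (g : ℚ[X]),
      ((l.foldl (fun p j => eulerOp (c j) p) (g * (1 - Polynomial.X) ^ l.length))).eval 1 =
      (-1) ^ l.length * (l.length.factorial : ℚ) * g.eval 1 by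
    intro g
    simpa using H (List.range s) g
  intro l
  induction l with
  | nil => intro g; simp
  | cons a l ih =>
    intro g
    obtain ⟨g', h1, h2⟩ := eulerOp_factor (c a) l.length g
    simp only [List.foldl_cons, List.length_cons]
    rw [h1, ih, h2, Nat.factorial_succ]
    push_cast
    ring

lemma eulerOp_sum (c : ℕ → ℚ) (T : Finset ℕ) (b : ℕ → ℚ) (d : ℕ → ℕ) (l : List ℕ) :
    (l.foldl (fun p j => eulerOp (c j) p) (∑ i ∈ T, Polynomial.C (b i) * Polynomial.X ^ (d i))) =
      ∑ i ∈ T, Polynomial.C (b i * (l.map fun j => ((d i : ℚ) - c j)).prod) * Polynomial.X ^ (d i) := by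
  induction l generalizing b with
  | nil => simp
  | cons a l ih =>
    simp only [List.foldl_cons, List.map_cons, List.prod_cons]
    have : eulerOp (c a) (∑ i ∈ T, Polynomial.C (b i) * Polynomial.X ^ (d i)) =
        ∑ i ∈ T, Polynomial.C (b i * ((d i : ℚ) - c a)) * Polynomial.X ^ (d i) := by
      unfold eulerOp
      simp only [derivative_sum, Finset.mul_sum, ← Finset.sum_sub_distrib]
      refine Finset.sum_congr rfl fun i _ => ?_
      rcases Nat.eq_zero_or_pos (d i) with h | h
      · simp [h, mul_comm]
      · obtain ⟨k, hk⟩ := Nat.exists_eq_succ_of_ne_zero h.ne'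
        rw [hk]
        simp
        ring
    rw [this, ih]
    simp only [mul_assoc]

lemma eval_one_of_factor (s : ℕ) (β d : ℕ → ℕ) (hd0 : d 0 = 0) (g : ℚ[X])
    (hg : ∑ i ∈ Finset.range (s + 1), Polynomial.C ((-1) ^ i * (β i : ℚ)) * Polynomial.X ^ (d i) = g * (1 - Polynomial.X) ^ s) :
    g.eval 1 * (s.factorial : ℚ) = (β 0 : ℚ) * ∏ j ∈ Finset.Icc 1 s, (d j : ℚ) := by
  have h1 := eulerOp_iter (fun j => (d (j + 1) : ℚ)) s g
  rw [← hg, eulerOp_sum] at h1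
  simp only [eval_finsetSum, Polynomial.eval_mul, Polynomial.eval_C, Polynomial.eval_pow, Polynomial.eval_X, one_pow, mul_one] at h1
  rw [Finset.sum_eq_single 0] at h1
  · simp only [hd0, pow_zero, one_mul, Nat.cast_zero, zero_sub] at h1
    have h2 : ((List.range s).map fun j => -(d (j + 1) : ℚ)).prod =
        (-1) ^ s * ∏ j ∈ Finset.Icc 1 s, (d j : ℚ) := by
      clear h1 hg
      induction s with
      | zero => simp
      | succ s ih =>
        rw [List.range_succ, List.map_append, List.prod_append, ih,
          Finset.prod_Icc_succ_top (by omega)]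
        simp
        ring
    rw [h2] at h1
    have h3 : ((-1 : ℚ) ^ s) ≠ 0 := by simp
    apply mul_left_cancel₀ h3
    linear_combination -h1
  · intro i hi hi0
    have : ((List.range s).map fun j => ((d i : ℚ) - (d (j + 1) : ℚ))).prod = 0 := by
      rw [List.prod_eq_zero_iff]
      simp only [List.mem_map, List.mem_range]
      refine ⟨i - 1, ?_, ?_⟩
      · simp at hi; omega
      · rw [Nat.sub_add_cancel (by omega)]; simp
    rw [this, mul_zero]
  · simp

lemma coeff_hilbertPoly (g : ℚ[X]) (r : ℕ) :
    (hilbertPoly g (r + 1)).natDegree ≤ r ∧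
    (r.factorial : ℚ) * (hilbertPoly g (r + 1)).coeff r = g.eval 1 := by
  rw [hilbertPoly_succ]
  constructor
  · apply natDegree_sum_le_of_forall_le _ _ <| fun _ _ => ?_
    apply le_trans (natDegree_smul_le _ _)
    rw [natDegree_preHilbertPoly]
  · simp only [finsetSum_coeff, Polynomial.coeff_smul, smul_eq_mul, coeff_preHilbertPoly_self]
    rw [← Finset.sum_mul, eval_eq_sum, Polynomial.sum_def]
    have : (r.factorial : ℚ) ≠ 0 := by positivity
    simp
    field_simp

lemma natDegree_le_of_bound (q : ℚ[X]) (r B N : ℕ)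
    (h : ∀ n : ℕ, N ≤ n → q.eval (n : ℚ) ≤ (B : ℚ) * ((n : ℚ) + 1) ^ r)
    (h0 : ∀ n : ℕ, N ≤ n → 0 ≤ q.eval (n : ℚ)) : q.natDegree ≤ r := by
  by_contra hlt
  push Not at hlt
  set Q : ℚ[X] := (Polynomial.X + 1) ^ r with hQ
  have hQm : Q.Monic := (Polynomial.monic_X_add_C (1 : ℚ)).pow r
  have hQd : Q.natDegree = r := by
    rw [hQ, ← Polynomial.C_1, natDegree_pow, natDegree_X_add_C, mul_one]
  have h1 := abs_div_tendsto_atTop_atTop_of_degree_gt q Q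
    (by apply degree_lt_degree; omega) hQm.ne_zero
  have h2 := (h1.comp (tendsto_natCast_atTop_atTop (R := ℚ))).eventually
    (Filter.eventually_gt_atTop (B : ℚ))
  obtain ⟨n, hn1, hn2⟩ := (h2.and (Filter.eventually_ge_atTop N)).exists
  simp only [Function.comp, hQ, Polynomial.eval_pow, Polynomial.eval_add, Polynomial.eval_X, eval_one] at hn1
  have hp : (0 : ℚ) < ((n : ℚ) + 1) ^ r := by positivity
  rw [abs_of_nonneg (div_nonneg (h0 n hn2) hp.le), lt_div_iff₀ hp] at hn1
  exact absurd (h n hn2) (not_le.mpr hn1)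

/-- Combine everything on the numerical side. -/
lemma numerical (m s : ℕ) (hsm : s < m) (β d : ℕ → ℕ) (hd0 : d 0 = 0)
    (hβ0 : β 0 ≠ 0) (hd : ∀ j, 1 ≤ j → j ≤ s → 0 < d j) (H : ℕ → ℕ)
    (hH : ∀ n, (H n : ℚ) = ∑ i ∈ Finset.range (s + 1), (-1) ^ i * ((β i : ℚ) *
      (if d i ≤ n then ((m - 1 + (n - d i)).choose (m - 1) : ℚ) else 0)))
    (C₀ : ℕ) (hC : ∀ n, ∑ i ∈ Finset.range (n + 1), H i ≤ C₀ * (n + 1) ^ (m - s)) :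
    ∃ q : Polynomial ℚ,
      (∃ N : ℕ, ∀ i : ℕ, N ≤ i → (H i : ℚ) = q.eval (i : ℚ)) ∧
      q.natDegree = m - s - 1 ∧
      ((m - s - 1).factorial : ℚ) * q.leadingCoeff * (s.factorial : ℚ) =
        (β 0 : ℚ) * ∏ j ∈ Finset.Icc 1 s, (d j : ℚ) := by
  set p : ℚ[X] := ∑ i ∈ Finset.range (s + 1), Polynomial.C ((-1) ^ i * (β i : ℚ)) * Polynomial.X ^ (d i) with hp
  have hser : ∀ n, (H n : ℚ) = ((p : PowerSeries ℚ) * (PowerSeries.invOneSubPow ℚ m).val).coeff n := by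
    intro n
    rw [hH, PowerSeries.invOneSubPow_val_eq_mk_sub_one_add_choose_of_pos _ _ (by omega), hp]
    rw [← coeToPowerSeries.ringHom_apply, map_sum, Finset.sum_mul, map_sum]
    refine Finset.sum_congr rfl fun i _ => ?_
    simp only [map_mul, map_pow, coeToPowerSeries.ringHom_apply, Polynomial.coe_C, Polynomial.coe_X]
    rw [← map_pow, ← map_mul, mul_assoc, PowerSeries.coeff_C_mul, PowerSeries.coeff_X_pow_mul', mul_assoc]
    simp
  have hsumser : ∀ n, ((∑ i ∈ Finset.range (n + 1), H i : ℕ) : ℚ) =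
      ((p : PowerSeries ℚ) * (PowerSeries.invOneSubPow ℚ (m + 1)).val).coeff n := by
    intro n
    have e : (PowerSeries.invOneSubPow ℚ (m + 1)).val =
        (PowerSeries.invOneSubPow ℚ m).val * PowerSeries.mk 1 := by
      obtain ⟨k, rfl⟩ : ∃ k, m = k + 1 := ⟨m - 1, by omega⟩
      rw [PowerSeries.invOneSubPow_val_succ_eq_mk_add_choose,
        PowerSeries.invOneSubPow_val_succ_eq_mk_add_choose,
        ← PowerSeries.mk_one_pow_eq_mk_choose_add, ← PowerSeries.mk_one_pow_eq_mk_choose_add,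
        pow_succ _ (k + 1)]
    rw [e, ← mul_assoc, PowerSeries.coeff_mul, Finset.Nat.sum_antidiagonal_eq_sum_range_succ_mk]
    push_cast
    refine Finset.sum_congr rfl fun i _ => ?_
    rw [hser]; simp
  have hdvd : ∃ g, p = g * (1 - Polynomial.X) ^ s := by
    by_cases hp0 : p = 0
    · exact ⟨0, by simp [hp0]⟩
    have hk : s ≤ p.rootMultiplicity 1 := by
      by_contra hlt
      push Not at hlt
      have h1 := natDegree_hilbertPoly_of_ne_zero_of_rootMultiplicity_lt (p := p) (d := m + 1) hp0
        (by omega)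
      have h2 := natDegree_le_of_bound (hilbertPoly p (m + 1)) (m - s) C₀ (p.natDegree + 1) ?_ ?_
      · omega
      · intro n hn
        rw [← coeff_mul_invOneSubPow_eq_hilbertPoly_eval _ (by omega), ← hsumser]
        exact_mod_cast hC n
      · intro n hn
        rw [← coeff_mul_invOneSubPow_eq_hilbertPoly_eval _ (by omega), ← hsumser]
        positivity
    have h3 : (Polynomial.X - Polynomial.C 1) ^ s ∣ p := (pow_dvd_pow _ hk).trans (pow_rootMultiplicity_dvd p 1)
    obtain ⟨g, hg⟩ := h3
    refine ⟨g * (-1) ^ s, ?_⟩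
    rw [hg, mul_assoc, ← mul_pow]
    simp [mul_comm]
  obtain ⟨g, hg⟩ := hdvd
  have hg1 := eval_one_of_factor s β d hd0 g hg
  obtain ⟨r, hr⟩ : ∃ r, m = r + 1 + s := ⟨m - s - 1, by omega⟩
  have hhp : hilbertPoly p m = hilbertPoly g (r + 1) := by
    rw [hg, hr, hilbertPoly_mul_one_sub_pow_add]
  obtain ⟨hle, hco⟩ := coeff_hilbertPoly g r
  have hne : g.eval 1 ≠ 0 := by
    intro h0
    rw [h0, zero_mul] at hg1
    have : (β 0 : ℚ) * ∏ j ∈ Finset.Icc 1 s, (d j : ℚ) ≠ 0 := by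
      refine mul_ne_zero (by exact_mod_cast hβ0) (Finset.prod_ne_zero_iff.mpr fun j hj => ?_)
      rw [Finset.mem_Icc] at hj
      exact_mod_cast (hd j hj.1 hj.2).ne'
    exact this hg1.symm
  have hdeg : (hilbertPoly g (r + 1)).natDegree = r := by
    apply natDegree_eq_of_le_of_coeff_ne_zero hle
    intro h0
    rw [h0, mul_zero] at hco
    exact hne hco.symm
  have hrm : m - s - 1 = r := by omega
  refine ⟨hilbertPoly p m, ⟨p.natDegree + 1, fun i hi => ?_⟩, ?_, ?_⟩
  · rw [hser, coeff_mul_invOneSubPow_eq_hilbertPoly_eval _ (by omega)]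
  · rw [hhp, hdeg, hrm]
  · rw [hrm, hhp, leadingCoeff, hdeg, hco, hg1]
end polyPart

section growthPart
open MvPolynomial

lemma ringKrullDim_le_of_integral {R S : Type*} [CommRing R] [CommRing S] (f : R →+* S)
    (hinj : Function.Injective f) (hfint : f.IsIntegral) : ringKrullDim R ≤ ringKrullDim S := by
  algebraize [f]
  have : FaithfulSMul R S := (faithfulSMul_iff_algebraMap_injective R S).mpr hinj
  refine iSup_le fun l => ?_
  obtain ⟨⟨Q, hQ1, hQ2⟩⟩ := Ideal.nonempty_primesOver (S := S) (RelSeries.head l).asIdeal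
  obtain ⟨L, hL, -⟩ := Ideal.exists_ltSeries_of_hasGoingUp (S := S) l Q
  rw [← hL]
  exact Order.LTSeries.length_le_krullDim L

lemma exists_fin_of_finite {R S : Type*} [CommRing R] [CommRing S] (f : R →+* S)
    (hf : f.Finite) : ∃ (J : ℕ) (b : Fin J → S), ∀ a, ∃ c : Fin J → R, ∑ j, f (c j) * b j = a := by
  algebraize [f]
  obtain ⟨J, b, hb⟩ := Module.Finite.exists_fin (R := R) (M := S)
  refine ⟨J, b, fun a => ?_⟩
  have ha : a ∈ Submodule.span R (Set.range b) := hb ▸ Submodule.mem_top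
  obtain ⟨c, hc⟩ := (Submodule.mem_span_range_iff_exists_fun _).mp ha
  refine ⟨c, ?_⟩
  rw [← hc]
  simp only [Algebra.smul_def]
  rfl

/-- The span of bounded monomials in `Y` times `u`. -/
def boxSpan (K : Type) [Field K] {P M : Type} [CommRing P] [AddCommGroup M] [Module K M]
    [Module P M] {r : ℕ} {ι : Type} (Y : Fin r → P) (u : ι → M) (N : ℕ) : Submodule K M :=
  Submodule.span K (Set.range fun x : (Fin r → Fin (N + 1)) × ι =>
    (∏ i, Y i ^ (x.1 i : ℕ)) • u x.2)

section box
variable {K : Type} [Field K] {P M : Type} [CommRing P] [Algebra K P] [AddCommGroup M] [Module K M]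
    [Module P M] [IsScalarTower K P M] {r : ℕ} {ι : Type} (Y : Fin r → P) (u : ι → M)

lemma mem_boxSpan (N : ℕ) (α : Fin r → ℕ) (hα : ∀ i, α i ≤ N) (k : ι) :
    (∏ i, Y i ^ α i) • u k ∈ boxSpan K Y u N :=
  Submodule.subset_span ⟨(fun i => ⟨α i, Nat.lt_succ_of_le (hα i)⟩, k), rfl⟩

lemma boxSpan_le_iff (N : ℕ) (W : Submodule K M) :
    boxSpan K Y u N ≤ W ↔ ∀ (α : Fin r → ℕ), (∀ i, α i ≤ N) → ∀ k, (∏ i, Y i ^ α i) • u k ∈ W := by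
  constructor
  · intro h α hα k
    exact h (mem_boxSpan Y u N α hα k)
  · intro h
    refine Submodule.span_le.mpr ?_
    rintro _ ⟨x, rfl⟩
    exact h (fun i => x.1 i) (fun i => Nat.le_of_lt_succ (x.1 i).2) x.2

lemma boxSpan_mono : Monotone (boxSpan K Y u) := by
  intro a b hab
  rw [boxSpan_le_iff]
  intro α hα k
  exact mem_boxSpan Y u b α (fun i => (hα i).trans hab) k

lemma monomial_smul_boxSpan (N D : ℕ) (α : Fin r → ℕ) (hα : ∀ i, α i ≤ N) (x : M)
    (hx : x ∈ boxSpan K Y u D) : (∏ i, Y i ^ α i) • x ∈ boxSpan K Y u (N + D) := by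
  have : boxSpan K Y u D ≤ (boxSpan K Y u (N + D)).comap
      (Module.toModuleEnd K (S := P) M (∏ i, Y i ^ α i)) := by
    rw [boxSpan_le_iff]
    intro γ hγ k
    simp only [Submodule.mem_comap, Module.toModuleEnd_apply, DistribSMul.toLinearMap_apply]
    rw [← mul_smul, ← Finset.prod_mul_distrib]
    simp only [← pow_add]
    exact mem_boxSpan Y u (N + D) (fun i => α i + γ i) (fun i => add_le_add (hα i) (hγ i)) k
  exact this hx

lemma smul_boxSpan (N D : ℕ) (p : P) (hp : ∀ k, p • u k ∈ boxSpan K Y u D) (x : M)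
    (hx : x ∈ boxSpan K Y u N) : p • x ∈ boxSpan K Y u (N + D) := by
  have : boxSpan K Y u N ≤ (boxSpan K Y u (N + D)).comap
      (Module.toModuleEnd K (S := P) M p) := by
    rw [boxSpan_le_iff]
    intro γ hγ k
    simp only [Submodule.mem_comap, Module.toModuleEnd_apply, DistribSMul.toLinearMap_apply]
    rw [smul_comm]
    exact monomial_smul_boxSpan Y u N D γ hγ _ (hp k)
  exact this hx

instance boxSpan_finite [Finite ι] (N : ℕ) : FiniteDimensional K (boxSpan K Y u N) := by
  unfold boxSpan
  exact FiniteDimensional.span_of_finite K (Set.finite_range _)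

lemma finrank_boxSpan [Fintype ι] (N : ℕ) :
    Module.finrank K (boxSpan K Y u N) ≤ Fintype.card ι * (N + 1) ^ r := by
  unfold boxSpan
  refine (finrank_range_le_card (R := K) _).trans ?_
  simp [mul_comm]

lemma aeval_smul_mem_iSup (c : MvPolynomial (Fin r) K) (k : ι) :
    aeval Y c • u k ∈ ⨆ N, boxSpan K Y u N := by
  rw [aeval_def, eval₂_eq', Finset.sum_smul]
  refine Submodule.sum_mem _ fun α _ => ?_
  rw [mul_smul, algebraMap_smul]
  refine Submodule.smul_mem _ _ (Submodule.mem_iSup_of_mem (∑ i, α i) ?_)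
  exact mem_boxSpan Y u _ α (fun i => Finset.single_le_sum (fun _ _ => Nat.zero_le _) (Finset.mem_univ i)) k

end box

lemma exists_box (K : Type) [Field K] (m : ℕ) (M : Type) [AddCommGroup M]
    [Module K M] [Module (MvPolynomial (Fin m) K) M]
    [IsScalarTower K (MvPolynomial (Fin m) K) M]
    [Module.Finite (MvPolynomial (Fin m) K) M] (r : ℕ)
    (hdim : ringKrullDim ((MvPolynomial (Fin m) K) ⧸
        Module.annihilator (MvPolynomial (Fin m) K) M) = (r : WithBot ℕ∞)) :
    ∃ (r' : ℕ) (_ : r' ≤ r) (J : ℕ) (L : ℕ) (Y : Fin r' → MvPolynomial (Fin m) K)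
      (u : Fin J × Fin L → M), ∀ z : M, ∃ N, z ∈ boxSpan K Y u N := by
  set I := Module.annihilator (MvPolynomial (Fin m) K) M with hI
  have : Nontrivial (MvPolynomial (Fin m) K ⧸ I) := by
    by_contra h
    rw [not_nontrivial_iff_subsingleton] at h
    rw [ringKrullDim_eq_bot_of_subsingleton] at hdim
    exact absurd hdim (by simp)
  obtain ⟨r', g, hinj, hfin⟩ := exists_finite_inj_algHom_of_fg K (MvPolynomial (Fin m) K ⧸ I)
  have hr : r' ≤ r := by
    have h1 := ringKrullDim_le_of_integral g.toRingHom hinj hfin.to_isIntegral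
    rw [hdim, MvPolynomial.ringKrullDim_of_isNoetherianRing, ringKrullDim_eq_zero_of_field] at h1
    simp only [zero_add, Nat.card_eq_fintype_card, Fintype.card_fin] at h1
    exact_mod_cast h1
  choose Y hY using fun i => Ideal.Quotient.mk_surjective (g (X i))
  have hgY : ∀ c, Ideal.Quotient.mk I (aeval Y c) = g c := by
    intro c
    have : (Ideal.Quotient.mkₐ K I).comp (aeval Y) = g := by
      apply MvPolynomial.algHom_ext
      intro i
      simp [hY]
    rw [← this]; rfl
  obtain ⟨J, b, hb⟩ : ∃ (J : ℕ) (b : Fin J → MvPolynomial (Fin m) K ⧸ I),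
      ∀ a, ∃ c : Fin J → MvPolynomial (Fin r') K, ∑ j, g (c j) * b j = a :=
    exists_fin_of_finite g.toRingHom hfin
  choose B hB using fun i => Ideal.Quotient.mk_surjective (b i)
  obtain ⟨L, v, hv⟩ := Module.Finite.exists_fin (R := MvPolynomial (Fin m) K) (M := M)
  refine ⟨r', hr, J, L, Y, fun x => B x.1 • v x.2, fun z => ?_⟩
  set u : Fin J × Fin L → M := fun x => B x.1 • v x.2 with hu
  suffices hz : z ∈ ⨆ N, boxSpan K Y u N by
    exact (Submodule.mem_iSup_of_directed _ (boxSpan_mono Y u).directed_le).mp hz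
  have hz : z ∈ Submodule.span (MvPolynomial (Fin m) K) (Set.range v) := hv ▸ Submodule.mem_top
  obtain ⟨c, rfl⟩ := (Submodule.mem_span_range_iff_exists_fun _).mp hz
  refine Submodule.sum_mem _ fun l _ => ?_
  obtain ⟨e, he⟩ := hb (Ideal.Quotient.mk I (c l))
  have h2 : (∑ j, aeval Y (e j) * B j) - c l ∈ I := by
    rw [← Ideal.Quotient.eq, ← he, map_sum]
    refine Finset.sum_congr rfl fun j _ => ?_
    rw [map_mul, hgY, hB]
  have h3 := Module.mem_annihilator.mp h2 (v l)
  rw [sub_smul, sub_eq_zero] at h3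
  rw [← h3, Finset.sum_smul]
  refine Submodule.sum_mem _ fun j _ => ?_
  rw [mul_smul]
  exact aeval_smul_mem_iSup Y u (e j) (j, l)

lemma growth (K : Type) [Field K] (m : ℕ) (M : Type) [AddCommGroup M]
    [Module K M] [Module (MvPolynomial (Fin m) K) M]
    [IsScalarTower K (MvPolynomial (Fin m) K) M]
    [Module.Finite (MvPolynomial (Fin m) K) M] (r : ℕ)
    (hdim : ringKrullDim ((MvPolynomial (Fin m) K) ⧸
        Module.annihilator (MvPolynomial (Fin m) K) M) = (r : WithBot ℕ∞))
    (b : ℕ) (v : Fin b → M) :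
    ∃ C : ℕ, ∀ n, ∃ W : Submodule K M, FiniteDimensional K W ∧
      Module.finrank K W ≤ C * (n + 1) ^ r ∧
      ∀ (ν : Fin m →₀ ℕ) (t : Fin b), ν.degree ≤ n → monomial ν (1 : K) • v t ∈ W := by
  obtain ⟨r', hr, J, L, Y, u, hbox⟩ := exists_box K m M r hdim
  choose N hN using hbox
  set D : ℕ := ∑ t, N (v t) + ∑ i : Fin m, ∑ k, N ((X i : MvPolynomial (Fin m) K) • u k) with hD
  have hDv : ∀ t, v t ∈ boxSpan K Y u D := fun t => boxSpan_mono Y u (by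
    have := Finset.single_le_sum (f := fun t => N (v t)) (fun _ _ => Nat.zero_le _) (Finset.mem_univ t)
    omega) (hN (v t))
  have hDu : ∀ i k, (X i : MvPolynomial (Fin m) K) • u k ∈ boxSpan K Y u D := fun i k =>
    boxSpan_mono Y u (by
    have h1 := Finset.single_le_sum (f := fun i => ∑ k, N ((X i : MvPolynomial (Fin m) K) • u k))
      (fun _ _ => Nat.zero_le _) (Finset.mem_univ i)
    have h2 := Finset.single_le_sum (f := fun k => N ((X i : MvPolynomial (Fin m) K) • u k))
      (fun _ _ => Nat.zero_le _) (Finset.mem_univ k)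
    omega) (hN _)
  refine ⟨Fintype.card (Fin J × Fin L) * (D + 1) ^ r', fun n =>
    ⟨boxSpan K Y u (D * n + D), inferInstance, ?_, ?_⟩⟩
  · refine (finrank_boxSpan Y u _).trans ?_
    rw [mul_assoc]
    refine Nat.mul_le_mul_left _ ?_
    calc (D * n + D + 1) ^ r' ≤ ((D + 1) * (n + 1)) ^ r' := Nat.pow_le_pow_left (by nlinarith) _
      _ = (D + 1) ^ r' * (n + 1) ^ r' := mul_pow _ _ _
      _ ≤ _ := Nat.mul_le_mul_left _ (Nat.pow_le_pow_right (by omega) hr)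
  · intro ν t
    induction n generalizing ν with
    | zero =>
      intro h
      have : ν = 0 := by
        rw [← Finsupp.degree_eq_zero_iff]; omega
      subst this
      simpa using hDv t
    | succ n ih =>
      intro h
      by_cases h0 : ν = 0
      · subst h0
        simpa using boxSpan_mono Y u (by nlinarith) (hDv t)
      · obtain ⟨i, hi⟩ := Finsupp.ne_iff.mp h0
        have hle : Finsupp.single i 1 ≤ ν := by
          rw [Finsupp.single_le_iff]
          exact Nat.one_le_iff_ne_zero.mpr hi
        have hsplit : ν = Finsupp.single i 1 + (ν - Finsupp.single i 1) :=
          (add_tsub_cancel_of_le hle).symm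
        have hdeg : (ν - Finsupp.single i 1).degree ≤ n := by
          have := congrArg Finsupp.degree hsplit
          rw [map_add, Finsupp.degree_single] at this
          omega
        have hmul : (monomial ν (1 : K)) = X i * monomial (ν - Finsupp.single i 1) 1 := by
          rw [X, monomial_mul, ← hsplit, one_mul]
        rw [hmul, mul_smul]
        have := smul_boxSpan Y u (D * n + D) D (X i) (hDu i) _ (ih _ hdeg)
        have e : D * (n + 1) + D = D * n + D + D := by ring
        rw [e]
        exact this
end growthPart

/-- **Proposition (paper, Proposition 4.7).** Let `M` be a finitely generated graded
Cohen–Macaulay `P₀`-module with pure minimal graded free resolution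
`0 → P₀^{β_s}(-d_s) → ⋯ → P₀^{β_1}(-d_1) → P₀^{β_0} → M → 0`, `s = codim M`.  Then the
multiplicity of `M` is `e(M) = (β_0/s!) ∏_{i=1}^s d_i`, where `e(M)` is the normalized
leading coefficient of the Hilbert polynomial `q` of `M`:
`q` has leading term `(e(M)/(dim M - 1)!)·iᵈⁱᵐ M⁻¹` with `dim M = m - s ≥ 1`. -/
theorem multiplicity_of_pure_resolution
    (K : Type) [Field K] (m : ℕ)
    (M : Type) [AddCommGroup M]
    [Module K M] [Module (MvPolynomial (Fin m) K) M]
    [IsScalarTower K (MvPolynomial (Fin m) K) M]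
    [Module.Finite (MvPolynomial (Fin m) K) M]
    -- a grading of `M`:
    (ℳ : ℤ → Submodule K M)
    (hdecomp : DirectSum.IsInternal ℳ)
    (hsmul : ∀ (e : ℕ) (p : MvPolynomial (Fin m) K), p.IsHomogeneous e →
      ∀ (i : ℤ) (x : M), x ∈ ℳ i → p • x ∈ ℳ (i + e))
    -- a pure graded free resolution
    -- `0 → P₀^{β s}(-d s) → ⋯ → P₀^{β 1}(-d 1) → P₀^{β 0} → M → 0`,
    -- with `d 0 = 0 < d 1 < d 2 < ⋯ < d s` (purity forces minimality here):
    (s : ℕ) (β : ℕ → ℕ) (d : ℕ → ℕ)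
    (hβ : ∀ i, s < i → β i = 0)
    (hd0 : d 0 = 0) (hd1 : 0 < d 1)
    (hdmono : ∀ i, 1 ≤ i → i < s → d i < d (i + 1))
    (ψ : ∀ i, ((Fin (β (i + 1))) →₀ MvPolynomial (Fin m) K) →ₗ[MvPolynomial (Fin m) K]
      ((Fin (β i)) →₀ MvPolynomial (Fin m) K))
    (ε : ((Fin (β 0)) →₀ MvPolynomial (Fin m) K) →ₗ[MvPolynomial (Fin m) K] M)
    (hsurj : Function.Surjective ε)
    (hexact₀ : Function.Exact (ψ 0) ε)
    (hexact : ∀ i, Function.Exact (ψ (i + 1)) (ψ i))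
    (hψgr : ∀ i s' t ν, MvPolynomial.coeff ν ((ψ i (Finsupp.single s' 1)) t) ≠ 0 →
      tdeg ν + d i = d (i + 1))
    (hεgr : ∀ t, ε (Finsupp.single t 1) ∈ ℳ 0)
    -- `M` is Cohen–Macaulay of codimension `s`:
    (hs : s ≤ m)
    (hcodim : ringKrullDim ((MvPolynomial (Fin m) K) ⧸
        Module.annihilator (MvPolynomial (Fin m) K) M) = ((m - s : ℕ) : WithBot ℕ∞))
    (hsm : s < m) :
    ∃ q : Polynomial ℚ,
      (∃ N : ℕ, ∀ i : ℕ, N ≤ i → (Module.finrank K ↥(ℳ (i : ℤ)) : ℚ) = q.eval (i : ℚ)) ∧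
      q.natDegree = m - s - 1 ∧
      ((m - s - 1).factorial : ℚ) * q.leadingCoeff * (s.factorial : ℚ) =
        (β 0 : ℚ) * ∏ j ∈ Finset.Icc 1 s, (d j : ℚ) := by
  classical
  have hm : 0 < m := by omega
  -- projections
  obtain ⟨π, hπ⟩ := exists_grProj_of_isInternal ℳ hdecomp
  have hS : ∀ i, GrProj K (strandG K m (fun _ : Fin (β i) => d i)) (strandProj K m (β i) (d i)) :=
    fun i => grProj_strand (β i) (d i)
  have hψmap : ∀ i e w, w ∈ strandG K m (fun _ : Fin (β (i + 1)) => d (i + 1)) e →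
      (ψ i).restrictScalars K w ∈ strandG K m (fun _ : Fin (β i) => d i) e :=
    fun i e w hw => strand_map (d (i + 1)) (d i) (ψ i) (hψgr i) e w hw
  have hεmap : ∀ e w, w ∈ strandG K m (fun _ : Fin (β 0) => d 0) e →
      ε.restrictScalars K w ∈ ℳ e := by
    intro e w hw
    rw [hd0] at hw
    exact strand_map_zero ℳ hsmul ε hεgr e w hw
  have hℳ : ∀ e, (strandG K m (fun _ : Fin (β 0) => d 0) e).map (ε.restrictScalars K) = ℳ e :=
    fun e => (hS 0).map_eq_of_surjective hπ (ε.restrictScalars K) hεmap hsurj e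
  have hex0 : ∀ e, (strandG K m (fun _ : Fin (β 1) => d 1) e).map ((ψ 0).restrictScalars K) =
      strandG K m (fun _ : Fin (β 0) => d 0) e ⊓ LinearMap.ker (ε.restrictScalars K) :=
    fun e => (hS 1).map_eq_of_exact (hS 0) ((ψ 0).restrictScalars K) (ε.restrictScalars K)
      (hψmap 0) hexact₀ e
  have hex : ∀ i e, (strandG K m (fun _ : Fin (β (i + 2)) => d (i + 2)) e).map
      ((ψ (i + 1)).restrictScalars K) =
      strandG K m (fun _ : Fin (β (i + 1)) => d (i + 1)) e ⊓
        LinearMap.ker ((ψ i).restrictScalars K) :=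
    fun i e => (hS (i + 2)).map_eq_of_exact (hS (i + 1)) ((ψ (i + 1)).restrictScalars K)
      ((ψ i).restrictScalars K) (hψmap (i + 1)) (hexact i) e
  have hfd : ∀ i (n : ℕ), FiniteDimensional K (strandG K m (fun _ : Fin (β i) => d i) (n : ℤ)) :=
    fun i n => (strand_finite (β i) (d i) n).1
  -- positivity of the shifts
  have hdpos : ∀ j, 1 ≤ j → j ≤ s → 0 < d j := by
    intro j hj
    induction j, hj using Nat.le_induction with
    | base => intro _; exact hd1
    | succ j hj ih =>
      intro hjs
      exact (ih (by omega)).trans (hdmono j hj (by omega))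
  -- `M ≠ 0`
  have hβ0 : β 0 ≠ 0 := by
    intro h0
    have hsub : Subsingleton M := by
      refine ⟨fun x y => ?_⟩
      obtain ⟨a, rfl⟩ := hsurj x
      obtain ⟨b, rfl⟩ := hsurj y
      have : IsEmpty (Fin (β 0)) := by rw [h0]; infer_instance
      rw [Subsingleton.elim a b]
    have hann : Module.annihilator (MvPolynomial (Fin m) K) M = ⊤ :=
      Module.annihilator_eq_top_iff.mpr hsub
    have : Subsingleton (MvPolynomial (Fin m) K ⧸ Module.annihilator (MvPolynomial (Fin m) K) M) :=
      Ideal.Quotient.subsingleton_iff.mpr hann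
    rw [ringKrullDim_eq_bot_of_subsingleton] at hcodim
    exact absurd hcodim (by simp)
  -- growth
  obtain ⟨C₀, hC₀⟩ := growth K m M (m - s) hcodim (β 0) (fun t => ε (Finsupp.single t 1))
  refine numerical m s hsm β d hd0 hβ0 hdpos (fun n => Module.finrank K (ℳ (n : ℤ))) ?_ C₀ ?_
  · intro n
    have h := alt_sum s (fun i => Module.finrank K (strandG K m (fun _ : Fin (β i) => d i) (n : ℤ)))
      (fun i => Nat.casesOn i (Module.finrank K (ℳ (n : ℤ))) (fun i =>
        Module.finrank K ((strandG K m (fun _ : Fin (β (i + 1)) => d (i + 1)) (n : ℤ)).map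
          ((ψ i).restrictScalars K)))) ?_ ?_
    · refine h.trans (Finset.sum_congr rfl fun i _ => ?_)
      rw [(strand_finite (K := K) (m := m) (β i) (d i) n).2 hm]
      push_cast
      rfl
    · intro i
      have := hfd i n
      cases i with
      | zero =>
        have h1 := finrank_map_add_inf (ε.restrictScalars K)
          (strandG K m (fun _ : Fin (β 0) => d 0) (n : ℤ))
        rw [hℳ, ← hex0] at h1
        exact h1
      | succ i =>
        have h1 := finrank_map_add_inf ((ψ i).restrictScalars K)
          (strandG K m (fun _ : Fin (β (i + 1)) => d (i + 1)) (n : ℤ))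
        rw [← hex] at h1
        exact h1
    · have := hfd (s + 1) n
      have h1 := Submodule.finrank_map_le ((ψ s).restrictScalars K)
        (strandG K m (fun _ : Fin (β (s + 1)) => d (s + 1)) (n : ℤ))
      rw [(strand_finite (K := K) (m := m) (β (s + 1)) (d (s + 1)) n).2 hm] at h1
      exact Nat.le_zero.mp (h1.trans_eq (mul_eq_zero_of_left (hβ (s + 1) (by omega)) _))
  · intro n
    obtain ⟨W, hW1, hW2, hW3⟩ := hC₀ n
    refine (hπ.sum_finrank_le n W ?_).trans hW2
    intro i hi
    rw [← hℳ]
    rintro _ ⟨w, hw, rfl⟩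
    have hsum : ε w = ∑ t, w t • ε (Finsupp.single t 1) := by
      conv_lhs => rw [← Finsupp.univ_sum_single w]
      rw [map_sum]
      refine Finset.sum_congr rfl fun t _ => ?_
      rw [← map_smul, Finsupp.smul_single, smul_eq_mul, mul_one]
    change ε w ∈ W
    rw [hsum]
    refine Submodule.sum_mem _ fun t _ => ?_
    rw [(w t).as_sum, Finset.sum_smul]
    refine Submodule.sum_mem _ fun ν hν => ?_
    have h1 := hw t ν (MvPolynomial.mem_support_iff.mp hν)
    have h2 : monomial ν (coeff ν (w t)) = (coeff ν (w t)) • monomial ν (1 : K) := by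
      rw [smul_monomial, smul_eq_mul, mul_one]
    rw [h2, smul_assoc]
    refine Submodule.smul_mem _ _ (hW3 ν t ?_)
    rw [hd0, tdeg_eq] at h1
    simp at h1
    omega


end Paper
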